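/- There exist absolute constants C > 0 and γ₀ > 0 such that for every γ > γ₀ and every unidirectional solitary wave solution (ψ, η, r) with R(s_c) < r ≤ R(0), the amplitude satisfies η̂ − η̌ ≤ C·γ⁻², where η̂ = η(0) is the depth at the crest and η̌ = inf η. -/

import Mathlib

noncomputable section

open Real Set

/-- Partial derivative of `ψ` in the horizontal variable. -/
def px (ψ : ℝ → ℝ → ℝ) (x y : ℝ) : ℝ := deriv (fun t => ψ t y) x

/-- Partial derivative of `ψ` in the vertical variable. -/
def py (ψ : ℝ → ℝ → ℝ) (x y : ℝ) : ℝ := deriv (fun t => ψ x t) y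

/-- Second partial derivative in `x`. -/
def pxx (ψ : ℝ → ℝ → ℝ) (x y : ℝ) : ℝ := deriv (fun t => px ψ t y) x

/-- Second partial derivative in `y`. -/
def pyy (ψ : ℝ → ℝ → ℝ) (x y : ℝ) : ℝ := deriv (fun t => py ψ x t) y

/-- Depth `d(s)` of the laminar (stream) flow with surface value `s` of `ψ_y`. -/
def lamDepth (γ s : ℝ) : ℝ := (-s + Real.sqrt (s ^ 2 + 2 * γ)) / γ

/-- Bernoulli constant `R(s) = ½ s² + γ + d(s)` of the laminar flow. -/
def bernR (γ s : ℝ) : ℝ := s ^ 2 / 2 + γ + lamDepth γ s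

/-- `s` is the (unique) positive critical point `s_c` of `R`, characterized by the
equation `s - 1/γ + s/(γ √(s² + 2γ)) = 0`. -/
def IsCrit (γ s : ℝ) : Prop :=
  0 < s ∧ s - 1 / γ + s / (γ * Real.sqrt (s ^ 2 + 2 * γ)) = 0

/-- A solution `(ψ, η, r)` of the stream-function formulation with constant adverse
vorticity `ω = -γ`:  `Δψ = γ` in the fluid domain `D_η`, the Bernoulli condition on the
surface, `ψ = 1` on the surface and `ψ = 0` on the flat bottom. -/
structure StreamSolution (γ : ℝ) (ψ : ℝ → ℝ → ℝ) (η : ℝ → ℝ) (r : ℝ) : Prop where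
  eta_smooth : ContDiff ℝ (⊤ : ℕ∞) η
  eta_pos : ∀ x, 0 < η x
  psi_smooth : ContDiff ℝ (⊤ : ℕ∞) (fun p : ℝ × ℝ => ψ p.1 p.2)
  laplace : ∀ x y, 0 < y → y < η x → pxx ψ x y + pyy ψ x y = γ
  bernoulli : ∀ x, (px ψ x (η x)) ^ 2 / 2 + (py ψ x (η x)) ^ 2 / 2 + η x = r
  surface_val : ∀ x, ψ x (η x) = 1
  bottom_val : ∀ x, ψ x 0 = 0

/-- The flow is unidirectional: `ψ_y > 0` everywhere in the fluid domain `D_η`. -/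
def Unidirectional (ψ : ℝ → ℝ → ℝ) (η : ℝ → ℝ) : Prop :=
  ∀ x y, 0 < y → y < η x → 0 < py ψ x y

/-- A Stokes wave with half-period `Λ`: the solution is `2Λ`-periodic and even in `x`,
and the surface profile is strictly decreasing from the crest (`x = 0`) to the
trough (`x = Λ`).  Thus `η̂ = max η = η 0` and `η̌ = min η = η Λ`. -/
structure StokesWave (γ : ℝ) (ψ : ℝ → ℝ → ℝ) (η : ℝ → ℝ) (r Λ : ℝ) : Prop where
  sol : StreamSolution γ ψ η r
  lam_pos : 0 < Λ
  eta_periodic : ∀ x, η (x + 2 * Λ) = η x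
  eta_even : ∀ x, η (-x) = η x
  psi_periodic : ∀ x y, ψ (x + 2 * Λ) y = ψ x y
  psi_even : ∀ x y, ψ (-x) y = ψ x y
  eta_anti : StrictAntiOn η (Set.Icc 0 Λ)

/-- A solitary wave (relative to the critical value `sc = s_c` of `γ`): the solution is
even in `x`, the profile is strictly decreasing on `(0, ∞)` and non-constant, and the
flow converges to a supercritical laminar flow `(U(·; s), d(s))` with `s > s_c`,
`R(s) = r` as `|x| → ∞`.  The crest is at `x = 0`, `η̂ = η 0` and `η̌ = inf η = d(s)`. -/
structure SolitaryWave (γ sc : ℝ) (ψ : ℝ → ℝ → ℝ) (η : ℝ → ℝ) (r : ℝ) : Prop where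
  sol : StreamSolution γ ψ η r
  eta_even : ∀ x, η (-x) = η x
  psi_even : ∀ x y, ψ (-x) y = ψ x y
  eta_anti : StrictAntiOn η (Set.Ioi 0)
  nonconst : ∃ x₁ x₂, η x₁ ≠ η x₂
  asymptotic : ∃ s, sc < s ∧ bernR γ s = r ∧
    ∀ ε > 0, ∃ X : ℝ, ∀ x : ℝ, X ≤ |x| →
      |η x - lamDepth γ s| ≤ ε ∧
      ∀ y ∈ Set.Icc 0 (η x), |px ψ x y| + |py ψ x y - (γ * y + s)| ≤ ε


/-- Joint smoothness of a function of two real variables. -/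
def Sm (u : ℝ → ℝ → ℝ) : Prop := ContDiff ℝ (⊤ : ℕ∞) (fun p : ℝ × ℝ => u p.1 p.2)

lemma Sm.fd {u : ℝ → ℝ → ℝ} (h : Sm u) (p : ℝ × ℝ) :
    HasFDerivAt (fun p : ℝ × ℝ => u p.1 p.2) (fderiv ℝ (fun p : ℝ × ℝ => u p.1 p.2) p) p :=
  (h.differentiable (by simp) p).hasFDerivAt

lemma Sm.hx' {u : ℝ → ℝ → ℝ} (h : Sm u) (x y : ℝ) :
    HasDerivAt (fun t => u t y) (fderiv ℝ (fun p : ℝ × ℝ => u p.1 p.2) (x, y) (1, 0)) x := by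
  have h1 : HasDerivAt (fun t : ℝ => (t, y)) ((1 : ℝ), (0 : ℝ)) x :=
    (hasDerivAt_id x).prodMk (hasDerivAt_const x y)
  exact (h.fd (x, y)).comp_hasDerivAt x h1

lemma Sm.hy' {u : ℝ → ℝ → ℝ} (h : Sm u) (x y : ℝ) :
    HasDerivAt (fun t => u x t) (fderiv ℝ (fun p : ℝ × ℝ => u p.1 p.2) (x, y) (0, 1)) y := by
  have h1 : HasDerivAt (fun t : ℝ => (x, t)) ((0 : ℝ), (1 : ℝ)) y :=
    (hasDerivAt_const y x).prodMk (hasDerivAt_id y)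
  exact (h.fd (x, y)).comp_hasDerivAt y h1

lemma Sm.px_eq {u : ℝ → ℝ → ℝ} (h : Sm u) (x y : ℝ) :
    px u x y = fderiv ℝ (fun p : ℝ × ℝ => u p.1 p.2) (x, y) (1, 0) := (h.hx' x y).deriv

lemma Sm.py_eq {u : ℝ → ℝ → ℝ} (h : Sm u) (x y : ℝ) :
    py u x y = fderiv ℝ (fun p : ℝ × ℝ => u p.1 p.2) (x, y) (0, 1) := (h.hy' x y).deriv

lemma Sm.hx {u : ℝ → ℝ → ℝ} (h : Sm u) (x y : ℝ) :
    HasDerivAt (fun t => u t y) (px u x y) x := by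
  rw [h.px_eq]; exact h.hx' x y

lemma Sm.hy {u : ℝ → ℝ → ℝ} (h : Sm u) (x y : ℝ) :
    HasDerivAt (fun t => u x t) (py u x y) y := by
  rw [h.py_eq]; exact h.hy' x y

lemma Sm.dpx {u : ℝ → ℝ → ℝ} (h : Sm u) : Sm (px u) := by
  have h1 : ContDiff ℝ (⊤ : ℕ∞) (fun p => fderiv ℝ (fun p : ℝ × ℝ => u p.1 p.2) p) :=
    ContDiff.fderiv_right h (by simp)
  have h2 : ContDiff ℝ (⊤ : ℕ∞)
      (fun p => fderiv ℝ (fun p : ℝ × ℝ => u p.1 p.2) p ((1 : ℝ), (0 : ℝ))) :=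
    h1.clm_apply contDiff_const
  unfold Sm
  convert h2 using 2 with p
  exact h.px_eq p.1 p.2

lemma Sm.dpy {u : ℝ → ℝ → ℝ} (h : Sm u) : Sm (py u) := by
  have h1 : ContDiff ℝ (⊤ : ℕ∞) (fun p => fderiv ℝ (fun p : ℝ × ℝ => u p.1 p.2) p) :=
    ContDiff.fderiv_right h (by simp)
  have h2 : ContDiff ℝ (⊤ : ℕ∞)
      (fun p => fderiv ℝ (fun p : ℝ × ℝ => u p.1 p.2) p ((0 : ℝ), (1 : ℝ))) :=
    h1.clm_apply contDiff_const
  unfold Sm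
  convert h2 using 2 with p
  exact h.py_eq p.1 p.2

lemma Sm.cont {u : ℝ → ℝ → ℝ} (h : Sm u) : Continuous (fun p : ℝ × ℝ => u p.1 p.2) :=
  ContDiff.continuous h

/-- The total derivative written through the partial derivatives. -/
lemma Sm.hcomp {u : ℝ → ℝ → ℝ} (h : Sm u) {a b : ℝ → ℝ} {a' b' x : ℝ}
    (ha : HasDerivAt a a' x) (hb : HasDerivAt b b' x) :
    HasDerivAt (fun t => u (a t) (b t)) (px u (a x) (b x) * a' + py u (a x) (b x) * b') x := by
  have h1 : HasDerivAt (fun t : ℝ => (a t, b t)) (a', b') x := ha.prodMk hb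
  have h2 := (h.fd (a x, b x)).comp_hasDerivAt x h1
  refine h2.congr_deriv ?_
  rw [h.px_eq, h.py_eq]
  have : ((a', b') : ℝ × ℝ) = a' • ((1 : ℝ), (0 : ℝ)) + b' • ((0 : ℝ), (1 : ℝ)) := by
    ext <;> simp
  rw [this, map_add, map_smul, map_smul]
  simp [mul_comm]

lemma Sm.comm {u : ℝ → ℝ → ℝ} (h : Sm u) (x y : ℝ) :
    py (px u) x y = px (py u) x y := by
  set U := fun p : ℝ × ℝ => u p.1 p.2 with hU
  have h1 : ContDiff ℝ (⊤ : ℕ∞) (fun p => fderiv ℝ U p) := ContDiff.fderiv_right h (by simp)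
  have h1d : HasFDerivAt (fun p => fderiv ℝ U p) (fderiv ℝ (fderiv ℝ U) (x, y)) (x, y) :=
    (h1.differentiable (by simp) (x, y)).hasFDerivAt
  have hs := second_derivative_symmetric (𝕜 := ℝ) (f := U) (f' := fderiv ℝ U)
    (f'' := fderiv ℝ (fderiv ℝ U) (x, y)) (x := (x, y)) (fun p => h.fd p) h1d
    ((1 : ℝ), (0 : ℝ)) ((0 : ℝ), (1 : ℝ))
  have ev : ∀ v : ℝ × ℝ, HasFDerivAt (fun p => fderiv ℝ U p v)
      ((ContinuousLinearMap.apply ℝ ℝ v).comp (fderiv ℝ (fderiv ℝ U) (x, y))) (x, y) := fun v =>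
    (ContinuousLinearMap.apply ℝ ℝ v).hasFDerivAt.comp (x, y) h1d
  have e1 : HasDerivAt (fun t => px u x t)
      (fderiv ℝ (fderiv ℝ U) (x, y) (0, 1) (1, 0)) y := by
    have hc : HasDerivAt (fun t : ℝ => (x, t)) ((0 : ℝ), (1 : ℝ)) y :=
      (hasDerivAt_const y x).prodMk (hasDerivAt_id y)
    have h3 := (ev (1, 0)).comp_hasDerivAt y hc
    have he : (fun t => px u x t) = fun t => fderiv ℝ U (x, t) (1, 0) :=
      funext fun t => h.px_eq x t
    rw [he]; exact h3
  have e2 : HasDerivAt (fun t => py u t y)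
      (fderiv ℝ (fderiv ℝ U) (x, y) (1, 0) (0, 1)) x := by
    have hc : HasDerivAt (fun t : ℝ => (t, y)) ((1 : ℝ), (0 : ℝ)) x :=
      (hasDerivAt_id x).prodMk (hasDerivAt_const x y)
    have h3 := (ev (0, 1)).comp_hasDerivAt x hc
    have he : (fun t => py u t y) = fun t => fderiv ℝ U (t, y) (0, 1) :=
      funext fun t => h.py_eq t y
    rw [he]; exact h3
  have a1 : py (px u) x y = _ := e1.deriv
  have a2 : px (py u) x y = _ := e2.deriv
  rw [a1, a2, hs]

/-- One-dimensional second order condition at a local minimum. -/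
lemma second_order {f f' : ℝ → ℝ} {x f'' : ℝ} (hf : ∀ t, HasDerivAt f (f' t) t)
    (hf' : HasDerivAt f' f'' x) (hm : IsLocalMin f x) : f' x = 0 ∧ 0 ≤ f'' := by
  have hd : deriv f = f' := funext fun t => (hf t).deriv
  have h0 : f' x = 0 := hm.hasDerivAt_eq_zero (hf x)
  refine ⟨h0, ?_⟩
  by_contra hneg
  push Not at hneg
  have hmax : IsLocalMax f x := by
    apply isLocalMax_of_deriv_deriv_neg
    · rw [hd, hf'.deriv]; exact hneg
    · rw [hd, h0]
    · exact (hf x).continuousAt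
  have hev : f =ᶠ[nhds x] fun _ => f x := by
    filter_upwards [hm, hmax] with t h1 h2
    exact le_antisymm h2 h1
  have h3 : deriv (deriv f) x = 0 := by
    have := hev.deriv.deriv
    have := this.eq_of_nhds
    simpa using this
  rw [hd, hf'.deriv] at h3
  linarith

/-- Differentiation under the integral sign for a smooth kernel. -/
lemma Sm.param {K : ℝ → ℝ → ℝ} (h : Sm K) (x : ℝ) :
    HasDerivAt (fun x => ∫ t in (0 : ℝ)..1, K x t) (∫ t in (0 : ℝ)..1, px K x t) x := by
  have hc := h.dpx.cont
  obtain ⟨M, hM⟩ := ((isCompact_Icc (a := x - 1) (b := x + 1)).prod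
    (isCompact_Icc (a := (0 : ℝ)) (b := 1))).exists_bound_of_continuousOn hc.continuousOn
  have hk : ∀ z, Continuous (fun t => K z t) := fun z => h.cont.comp (by fun_prop : Continuous fun t : ℝ => (z, t))
  have hk' : ∀ z, Continuous (fun t => px K z t) := fun z => hc.comp (by fun_prop : Continuous fun t : ℝ => (z, t))
  have := intervalIntegral.hasDerivAt_integral_of_dominated_loc_of_deriv_le
    (μ := MeasureTheory.volume) (F := K) (F' := px K) (x₀ := x) (a := 0) (b := 1)
    (s := Icc (x - 1) (x + 1)) (bound := fun _ => M)
    (Icc_mem_nhds (by linarith) (by linarith))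
    (Filter.Eventually.of_forall fun z => (hk z).aestronglyMeasurable)
    ((hk x).intervalIntegrable _ _) (hk' x).aestronglyMeasurable
    (by
      refine Filter.Eventually.of_forall fun t ht z hz => ?_
      rw [uIoc_of_le (by norm_num)] at ht
      exact hM (z, t) ⟨hz, ht.1.le, ht.2⟩)
    (by simp)
    (Filter.Eventually.of_forall fun t ht z hz => h.hx z t)
  exact this.2

/-- The Harnack inequality in the form used below. -/
lemma harnack {g : ℂ → ℂ} {R c : ℝ} (hR : 0 < R) (hg : DifferentiableOn ℂ g (Metric.ball 0 R))
    (hpos : ∀ z ∈ Metric.ball (0 : ℂ) R, 0 ≤ (g z).re) (h0 : g 0 = (c : ℂ))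
    {z : ℂ} (hz : ‖z‖ ≤ R / 2) : (g z).re ≤ 3 * c := by
  have hc : 0 ≤ c := by
    have := hpos 0 (by simp [hR]); rw [h0] at this; simpa using this
  refine le_of_forall_pos_le_add fun δ hδ => ?_
  set k : ℝ := c + δ / 4 with hk
  have hkpos : 0 < k := by linarith
  set G : ℂ → ℂ := fun z => (g z + (δ / 4 : ℝ) - k) / (g z + (δ / 4 : ℝ) + k) with hG
  have hre : ∀ z ∈ Metric.ball (0 : ℂ) R, 0 < (g z + (δ / 4 : ℝ)).re := fun z hz => by
    have := hpos z hz
    simp only [Complex.add_re, Complex.ofReal_re]; linarith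
  have hne : ∀ z ∈ Metric.ball (0 : ℂ) R, g z + (δ / 4 : ℝ) + k ≠ 0 := fun z hz he => by
    have h1 := hre z hz
    have h2 := congrArg Complex.re he
    rw [Complex.add_re] at h2
    simp only [Complex.ofReal_re, Complex.zero_re] at h2
    linarith
  have hGd : DifferentiableOn ℂ G (Metric.ball 0 R) :=
    ((hg.add_const _).sub_const _).div ((hg.add_const _).add_const _) hne
  have hmaps : MapsTo G (Metric.ball 0 R) (Metric.ball (G 0) 1) := by
    intro z hz
    have hG0 : G 0 = 0 := by simp [hG, h0, hk]
    rw [hG0, mem_ball_zero_iff]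
    simp only [hG]
    rw [norm_div, div_lt_one (norm_pos_iff.mpr (hne z hz))]
    have h1 := hre z hz
    set v := g z + (δ / 4 : ℝ) with hv
    rw [← sq_lt_sq₀ (norm_nonneg _) (norm_nonneg _), Complex.sq_norm, Complex.sq_norm,
      Complex.normSq_apply, Complex.normSq_apply]
    simp only [Complex.sub_re, Complex.add_re, Complex.sub_im, Complex.add_im, Complex.ofReal_re,
      Complex.ofReal_im]
    nlinarith [mul_pos h1 hkpos]
  have hzR : z ∈ Metric.ball (0 : ℂ) R := by
    rw [mem_ball_zero_iff]; linarith
  have hS := Complex.dist_le_div_mul_dist_of_mapsTo_ball hGd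
    (hmaps.mono_right Metric.ball_subset_closedBall) hzR
  have hG0 : G 0 = 0 := by simp [hG, h0, hk]
  rw [hG0, dist_zero_right, dist_zero_right] at hS
  have hS2 : ‖G z‖ ≤ 1 / 2 := by
    refine hS.trans ?_
    rw [div_mul_eq_mul_div, one_mul, div_le_iff₀ hR]; linarith
  simp only [hG] at hS2
  rw [norm_div, div_le_iff₀ (norm_pos_iff.mpr (hne z hzR))] at hS2
  have h1 := hre z hzR
  have hv : (g z).re + δ / 4 = (g z + (δ / 4 : ℝ)).re := by simp
  set v := g z + (δ / 4 : ℝ) with hv'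
  have t1 : ‖v‖ - k ≤ ‖v - k‖ := by
    have := norm_sub_norm_le v (k : ℂ)
    simpa [abs_of_pos hkpos] using this
  have t2 : ‖v + k‖ ≤ ‖v‖ + k := by
    have := norm_add_le v (k : ℂ)
    simpa [abs_of_pos hkpos] using this
  have t3 := Complex.re_le_norm v
  linarith

/-- Extraction of a minimum point on a bounded piece of the fluid domain. -/
lemma min_compact {u : ℝ → ℝ → ℝ} (hu : Continuous fun p : ℝ × ℝ => u p.1 p.2) {h : ℝ → ℝ}
    (hh : Continuous h) {X m : ℝ}
    (hside : ∀ x y, |x| = X → 0 ≤ y → y ≤ h x → m ≤ u x y)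
    (htop : ∀ x, |x| ≤ X → 0 ≤ h x → m ≤ u x (h x))
    {x₀ y₀ : ℝ} (hx₀ : |x₀| ≤ X) (hy₀ : 0 ≤ y₀) (hy₀' : y₀ ≤ h x₀) (hlt : u x₀ y₀ < m) :
    ∃ x y, |x| < X ∧ 0 ≤ y ∧ y < h x ∧ u x y < m ∧ IsLocalMin (fun t => u t y) x ∧
      (0 < y → IsLocalMin (fun t => u x t) y) ∧ (∀ᶠ t in nhdsWithin y (Ioi y), u x y ≤ u x t) := by
  set K : Set (ℝ × ℝ) := {p | |p.1| ≤ X ∧ 0 ≤ p.2 ∧ p.2 ≤ h p.1} with hK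
  have hclosed : IsClosed K := by
    have c1 : IsClosed {p : ℝ × ℝ | |p.1| ≤ X} := isClosed_le (by fun_prop) (by fun_prop)
    have c2 : IsClosed {p : ℝ × ℝ | 0 ≤ p.2} := isClosed_le (by fun_prop) (by fun_prop)
    have c3 : IsClosed {p : ℝ × ℝ | p.2 ≤ h p.1} := isClosed_le (by fun_prop) (by fun_prop)
    exact c1.inter (c2.inter c3)
  obtain ⟨M, hM⟩ := (isCompact_Icc (a := -X) (b := X)).exists_bound_of_continuousOn hh.continuousOn
  have hKc : IsCompact K := by
    refine ((isCompact_Icc (a := -X) (b := X)).prod (isCompact_Icc (a := 0) (b := M))).of_isClosed_subset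
      hclosed ?_
    rintro ⟨x, y⟩ ⟨h1, h2, h3⟩
    have hx := abs_le.mp h1
    refine ⟨hx, h2, h3.trans ((le_abs_self _).trans (hM x hx))⟩
  obtain ⟨⟨x, y⟩, ⟨h1, h2, h3⟩, hmin⟩ := hKc.exists_isMinOn ⟨(x₀, y₀), hx₀, hy₀, hy₀'⟩
    hu.continuousOn
  simp only at h1 h2 h3
  have hle : ∀ a b, |a| ≤ X → 0 ≤ b → b ≤ h a → u x y ≤ u a b := fun a b ha hb hb' =>
    hmin (a := (a, b)) ⟨ha, hb, hb'⟩
  have hval : u x y < m := (hle x₀ y₀ hx₀ hy₀ hy₀').trans_lt hlt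
  have hx : |x| < X := lt_of_le_of_ne h1 fun he => absurd (hside x y he h2 h3) (not_le.mpr hval)
  have hy : y < h x := lt_of_le_of_ne h3 fun he => by
    have := htop x h1 (he ▸ h2)
    rw [← he] at this
    linarith
  refine ⟨x, y, hx, h2, hy, hval, ?_, ?_, ?_⟩
  · have e1 : ∀ᶠ t in nhds x, |t| < X := continuous_abs.continuousAt.eventually_lt_const hx
    have e2 : ∀ᶠ t in nhds x, y < h t := hh.continuousAt.eventually_const_lt hy
    filter_upwards [e1, e2] with t ht1 ht2
    exact hle t y ht1.le h2 ht2.le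
  · intro hpos
    filter_upwards [Ioi_mem_nhds hpos, Iio_mem_nhds hy] with t ht1 ht2
    exact hle x t h1 (le_of_lt ht1) (le_of_lt ht2)
  · filter_upwards [self_mem_nhdsWithin, nhdsWithin_le_nhds (Iio_mem_nhds hy)] with t ht1 ht2
    exact hle x t h1 (h2.trans (le_of_lt ht1)) (le_of_lt ht2)

/-- The data of the solitary wave in the form used in the proof. -/
structure Setup (γ s d r : ℝ) (ψ : ℝ → ℝ → ℝ) (η : ℝ → ℝ) : Prop where
  hγ : 1000 < γ
  hs : 0 < s
  hsγ : s * γ ≤ 2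
  hd : 0 < d
  hdq : γ * d ^ 2 / 2 + s * d = 1
  hr : r = s ^ 2 / 2 + γ + d
  sol : StreamSolution γ ψ η r
  psi_even : ∀ x y, ψ (-x) y = ψ x y
  uni : Unidirectional ψ η
  eta_ge : ∀ x, d ≤ η x
  eta_le : ∀ x, η x ≤ η 0
  eta_mono : ∀ x y, |x| ≤ |y| → η y ≤ η x
  asym : ∀ ε > 0, ∃ X : ℝ, ∀ x : ℝ, X ≤ |x| → |η x - d| ≤ ε ∧
      ∀ y ∈ Set.Icc 0 (η x), |px ψ x y| + |py ψ x y - (γ * y + s)| ≤ ε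

/-- A property closed in `y` passes from the open to the closed column. -/
lemma column_closure {f : ℝ → ℝ} (hf : Continuous f) {b c : ℝ} (hb : 0 < b)
    (h : ∀ y, 0 < y → y < b → c ≤ f y) {y : ℝ} (h0 : 0 ≤ y) (h1 : y ≤ b) : c ≤ f y := by
  have hcl : IsClosed {y | c ≤ f y} := isClosed_le continuous_const hf
  have hsub : closure (Ioo 0 b) ⊆ {y | c ≤ f y} :=
    hcl.closure_subset_iff.mpr fun y hy => h y hy.1 hy.2
  rw [closure_Ioo hb.ne] at hsub
  exact hsub ⟨h0, h1⟩

lemma Sm.cy {u : ℝ → ℝ → ℝ} (h : Sm u) (x : ℝ) : Continuous fun y => u x y :=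
  h.cont.comp (by fun_prop : Continuous fun t : ℝ => (x, t))

section setup
variable {γ s d r : ℝ} {ψ : ℝ → ℝ → ℝ} {η : ℝ → ℝ}

lemma Setup.sm (S : Setup γ s d r ψ η) : Sm ψ := S.sol.psi_smooth

lemma Setup.etac (S : Setup γ s d r ψ η) : Continuous η := S.sol.eta_smooth.continuous

lemma Setup.lap (S : Setup γ s d r ψ η) {x y : ℝ} (h0 : 0 ≤ y) (h1 : y ≤ η x) :
    px (px ψ) x y + py (py ψ) x y = γ := by
  have hc : Continuous fun y => px (px ψ) x y + py (py ψ) x y :=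
    (S.sm.dpx.dpx.cy x).add (S.sm.dpy.dpy.cy x)
  apply le_antisymm
  · have := column_closure (f := fun y => -(px (px ψ) x y + py (py ψ) x y)) (c := -γ) hc.neg
      (S.sol.eta_pos x)
      (fun y h0 h1 => by have := S.sol.laplace x y h0 h1; simp only [pxx, pyy] at this
                         simp only [px, py]; simp only [px, py] at this; linarith) h0 h1
    linarith
  · exact column_closure hc (S.sol.eta_pos x)
      (fun y h0 h1 => by have := S.sol.laplace x y h0 h1; simp only [pxx, pyy] at this
                         simp only [px, py]; simp only [px, py] at this; linarith) h0 h1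

lemma Setup.py_nonneg (S : Setup γ s d r ψ η) {x y : ℝ} (h0 : 0 ≤ y) (h1 : y ≤ η x) :
    0 ≤ py ψ x y :=
  column_closure (S.sm.dpy.cy x) (S.sol.eta_pos x) (fun y h0 h1 => (S.uni x y h0 h1).le) h0 h1

lemma Setup.harm_y (S : Setup γ s d r ψ η) {x y : ℝ} (h0 : 0 < y) (h1 : y < η x) :
    px (px (py ψ)) x y + py (py (py ψ)) x y = 0 := by
  have e1 : px (px (py ψ)) x y = py (px (px ψ)) x y := by
    have : px (py ψ) = py (px ψ) := by funext a b; exact (S.sm.comm a b).symm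
    rw [this, S.sm.dpx.comm]
  have h2 := (S.sm.dpx.dpx.hy x y).add (S.sm.dpy.dpy.hy x y)
  have h3 : HasDerivAt (fun t => px (px ψ) x t + py (py ψ) x t) 0 y := by
    refine (hasDerivAt_const y γ).congr_of_eventuallyEq ?_
    filter_upwards [Ioo_mem_nhds h0 h1] with t ht
    exact S.lap ht.1.le ht.2.le
  rw [e1]
  exact h2.unique h3

lemma Setup.harm_x (S : Setup γ s d r ψ η) {x y : ℝ} (h0 : 0 < y) (h1 : y < η x) :
    px (px (px ψ)) x y + py (py (px ψ)) x y = 0 := by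
  have e1 : py (py (px ψ)) x y = px (py (py ψ)) x y := by
    have : py (px ψ) = px (py ψ) := by funext a b; exact S.sm.comm a b
    rw [this, S.sm.dpy.comm]
  have h2 := (S.sm.dpx.dpx.hx x y).add (S.sm.dpy.dpy.hx x y)
  have h3 : HasDerivAt (fun t => px (px ψ) t y + py (py ψ) t y) 0 x := by
    refine (hasDerivAt_const x γ).congr_of_eventuallyEq ?_
    filter_upwards [S.etac.continuousAt.eventually_const_lt h1] with t ht
    exact S.lap h0.le ht.le
  rw [e1]
  exact h2.unique h3

lemma Setup.px_bot (S : Setup γ s d r ψ η) (x : ℝ) : px ψ x 0 = 0 := by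
  have : (fun t => ψ t 0) = fun _ => 0 := funext S.sol.bottom_val
  simp [px, this]

lemma Setup.pxx_bot (S : Setup γ s d r ψ η) (x : ℝ) : px (px ψ) x 0 = 0 := by
  have : (fun t => px ψ t 0) = fun _ => 0 := funext S.px_bot
  rw [px]; simp [this]

lemma Setup.pyy_bot (S : Setup γ s d r ψ η) (x : ℝ) : py (py ψ) x 0 = γ := by
  have := S.lap (x := x) le_rfl (S.sol.eta_pos x).le
  rw [S.pxx_bot] at this; linarith

lemma Setup.etad (S : Setup γ s d r ψ η) (x : ℝ) : HasDerivAt η (deriv η x) x :=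
  (S.sol.eta_smooth.differentiable (by simp) x).hasDerivAt

lemma Setup.top (S : Setup γ s d r ψ η) (x : ℝ) :
    px ψ x (η x) + py ψ x (η x) * deriv η x = 0 := by
  have h := S.sm.hcomp (hasDerivAt_id x) (S.etad x)
  have he : (fun t => ψ (id t) (η t)) = fun _ => 1 := funext S.sol.surface_val
  rw [he] at h
  have := h.unique (hasDerivAt_const x 1)
  simpa using this

lemma Setup.px_zero (S : Setup γ s d r ψ η) (y : ℝ) : px ψ 0 y = 0 := by
  have h := S.sm.hx 0 y
  have h2 : HasDerivAt (fun t => ψ (-t) y) (px ψ 0 y * (-1)) 0 := by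
    have h' : HasDerivAt (fun t => ψ t y) (px ψ 0 y) (-0) := by simpa using h
    exact h'.comp 0 (hasDerivAt_neg 0)
  have he : (fun t => ψ (-t) y) = fun t => ψ t y := funext fun t => S.psi_even t y
  rw [he] at h2
  have := h.unique h2
  linarith

lemma Setup.Q0 (S : Setup γ s d r ψ η) : (s + γ * d) ^ 2 = s ^ 2 + 2 * γ := by
  have := S.hdq
  linear_combination (2 * γ) * this

/-- Weak minimum principle in the fluid domain. -/
lemma Setup.minprinc (S : Setup γ s d r ψ η) {u : ℝ → ℝ → ℝ} (hu : Sm u) {m : ℝ}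
    (hasy : ∀ ε > 0, ∃ X : ℝ, ∀ x y : ℝ, X ≤ |x| → 0 ≤ y → y ≤ η x → m - ε ≤ u x y)
    (htop : ∀ x, m ≤ u x (η x)) (hbot : ∀ x, m ≤ u x 0 ∨ py u x 0 ≤ 0)
    (hlap : ∀ x y, 0 < y → y < η x → px (px u) x y + py (py u) x y ≤ 0)
    {x₀ y₀ : ℝ} (hy₀ : 0 ≤ y₀) (hy₀' : y₀ ≤ η x₀) : m ≤ u x₀ y₀ := by
  by_contra hlt
  push Not at hlt
  set H := η 0 with hH
  have hHpos : 0 < H := S.sol.eta_pos 0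
  set e := (m - u x₀ y₀) / 4 with he
  have hepos : 0 < e := by linarith
  set δ := e / (H + H ^ 2) with hδ
  have hδpos : 0 < δ := by positivity
  have hδH : δ * (H + H ^ 2) = e := by rw [hδ]; field_simp
  obtain ⟨X, hX⟩ := hasy e hepos
  set v : ℝ → ℝ → ℝ := fun x y => u x y - δ * (y + y ^ 2) with hv
  have hcv : Continuous fun p : ℝ × ℝ => v p.1 p.2 := by
    have := hu.cont
    simp only [hv]
    fun_prop
  have hb : ∀ y, 0 ≤ y → y ≤ H → δ * (y + y ^ 2) ≤ e := fun y h0 h1 => by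
    rw [← hδH]; gcongr
  obtain ⟨x, y, -, h2, h3, h4, h5, h6, h7⟩ := min_compact (u := v) hcv S.etac
    (X := max X |x₀|) (m := m - 2 * e)
    (by
      intro x y hx h0 h1
      rcases le_total X |x₀| with hle | hle
      · have := hX x y (by rw [hx]; exact le_max_left _ _) h0 h1
        have := hb y h0 (h1.trans (S.eta_le x))
        simp only [hv]; linarith
      · have := hX x y (by rw [hx]; exact le_max_left _ _) h0 h1
        have := hb y h0 (h1.trans (S.eta_le x))
        simp only [hv]; linarith)
    (by
      intro x _ h0
      have := hb (η x) h0 (S.eta_le x)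
      have := htop x
      simp only [hv]; linarith)
    (le_max_right X |x₀|) hy₀ hy₀'
    (by
      have : 0 ≤ δ * (y₀ + y₀ ^ 2) := by positivity
      simp only [hv]; linarith)
  have hdy : ∀ t, HasDerivAt (fun t => v x t) (py u x t - δ * (1 + 2 * t)) t := fun t => by
    have := (hu.hy x t).sub (((hasDerivAt_id t).add ((hasDerivAt_id t).pow 2)).const_mul δ)
    refine this.congr_deriv ?_
    simp
  rcases h2.eq_or_lt with h0 | h0
  · subst h0
    rcases hbot x with hb1 | hb1
    · simp only [hv] at h4; norm_num at h4; linarith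
    · have hneg : py u x 0 - δ * (1 + 2 * 0) < 0 := by linarith
      have hsl := (hdy 0).tendsto_slope
      have hev := hsl.eventually_lt_const hneg
      have hev2 : ∀ᶠ t in nhdsWithin (0 : ℝ) (Ioi 0), slope (fun t => v x t) 0 t < 0 :=
        hev.filter_mono (nhdsWithin_mono (0 : ℝ) (s := Ioi 0) (t := {0}ᶜ)
          (fun t (ht : 0 < t) => ht.ne'))
      obtain ⟨t, ht1, ht2, ht3⟩ := (hev2.and (h7.and self_mem_nhdsWithin)).exists
      rw [slope_def_field, sub_zero] at ht1
      have ht3' : 0 < t := ht3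
      rw [div_lt_iff₀ ht3'] at ht1
      linarith
  · have hyy : HasDerivAt (fun t => py u x t - δ * (1 + 2 * t)) (py (py u) x y - 2 * δ) y := by
      have := (hu.dpy.hy x y).sub ((((hasDerivAt_id y).const_mul 2).const_add 1).const_mul δ)
      refine this.congr_deriv ?_
      ring
    have hdx : ∀ t, HasDerivAt (fun t => v t y) (px u t y) t := fun t =>
      (hu.hx t y).sub_const _
    have a1 := second_order hdy hyy (h6 h0)
    have a2 := second_order hdx (hu.dpx.hx x y) h5
    have := hlap x y h0 h3
    linarith [a1.2, a2.2]

lemma Sm.const_sub' {u : ℝ → ℝ → ℝ} (h : Sm u) (a b : ℝ) : Sm (fun x y => a + b * y - u x y) := by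
  unfold Sm at *
  fun_prop

lemma Sm.const_add' {u : ℝ → ℝ → ℝ} (h : Sm u) (a : ℝ) : Sm (fun x y => a + u x y) := by
  unfold Sm at *
  fun_prop

lemma px_cs {u : ℝ → ℝ → ℝ} (h : Sm u) (a b x y : ℝ) :
    px (fun x y => a + b * y - u x y) x y = - px u x y := by
  have := ((h.hx x y).const_sub (a + b * y)).deriv
  simpa [px] using this

lemma py_cs {u : ℝ → ℝ → ℝ} (h : Sm u) (a b x y : ℝ) :
    py (fun x y => a + b * y - u x y) x y = b - py u x y := by
  have := ((((hasDerivAt_id y).const_mul b).const_add a).sub (h.hy x y)).deriv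
  rw [mul_one] at this
  exact this

lemma lap_cs {u : ℝ → ℝ → ℝ} (h : Sm u) (a b x y : ℝ) :
    px (px (fun x y => a + b * y - u x y)) x y + py (py (fun x y => a + b * y - u x y)) x y
      = - (px (px u) x y + py (py u) x y) := by
  have e1 : px (fun x y => a + b * y - u x y) = fun x y => 0 + 0 * y - px u x y := by
    funext x y; rw [px_cs h]; ring
  have e2 : py (fun x y => a + b * y - u x y) = fun x y => b + 0 * y - py u x y := by
    funext x y; rw [py_cs h]; ring
  rw [e1, e2, px_cs h.dpx, py_cs h.dpy]; ring

lemma Setup.top_sq (S : Setup γ s d r ψ η) (x : ℝ) :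
    px ψ x (η x) ^ 2 + py ψ x (η x) ^ 2 ≤ (s + γ * d) ^ 2 := by
  have h1 := S.sol.bernoulli x
  have h2 := S.eta_ge x
  rw [S.Q0]; rw [S.hr] at h1; linarith

lemma Setup.Q0pos (S : Setup γ s d r ψ η) : 0 < s + γ * d := by
  have := S.hs; have := S.hd; have := S.hγ; positivity

/-- `ψ_y ≤ γ y + s` in the fluid. -/
lemma Setup.w_nonneg (S : Setup γ s d r ψ η) {x y : ℝ} (h0 : 0 ≤ y) (h1 : y ≤ η x) :
    0 ≤ s + γ * y - py ψ x y := by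
  have hγ : 0 < γ := by linarith [S.hγ]
  refine S.minprinc (S.sm.dpy.const_sub' s γ) (m := 0) ?_ ?_ ?_ ?_ h0 h1
  · intro ε hε
    obtain ⟨X, hX⟩ := S.asym ε hε
    refine ⟨X, fun x y hx h0 h1 => ?_⟩
    have a := (hX x hx).2 y ⟨h0, h1⟩
    have b := le_abs_self (py ψ x y - (γ * y + s))
    have c := abs_nonneg (px ψ x y)
    linarith
  · intro x
    have h1 := S.top_sq x
    have h2 : py ψ x (η x) ≤ s + γ * d := by
      apply le_of_sq_le_sq _ S.Q0pos.le
      nlinarith [sq_nonneg (px ψ x (η x))]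
    have := mul_le_mul_of_nonneg_left (S.eta_ge x) hγ.le
    linarith
  · intro x
    right
    rw [py_cs S.sm.dpy, S.pyy_bot]; simp
  · intro x y h0 h1
    rw [lap_cs S.sm.dpy, S.harm_y h0 h1]; simp

/-- `ψ_y ≤ √(s² + 2γ)` in the fluid. -/
lemma Setup.py_le (S : Setup γ s d r ψ η) {x y : ℝ} (h0 : 0 ≤ y) (h1 : y ≤ η x) :
    py ψ x y ≤ s + γ * d := by
  have hγ : 0 < γ := by linarith [S.hγ]
  have := S.minprinc (S.sm.dpy.const_sub' (s + γ * d) 0) (m := 0) ?_ ?_ ?_ ?_ h0 h1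
  · linarith
  · intro ε hε
    obtain ⟨X, hX⟩ := S.asym (ε / (γ + 1)) (by positivity)
    refine ⟨X, fun x y hx h0 h1 => ?_⟩
    have a := (hX x hx).2 y ⟨h0, h1⟩
    have a' := abs_le.mp (hX x hx).1
    have b := le_abs_self (py ψ x y - (γ * y + s))
    have c := abs_nonneg (px ψ x y)
    have e : (ε / (γ + 1)) * (γ + 1) = ε := by field_simp
    have f : γ * y ≤ γ * (d + ε / (γ + 1)) := by gcongr; linarith
    linarith
  · intro x
    have h1 := S.top_sq x
    have h2 : py ψ x (η x) ≤ s + γ * d := by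
      apply le_of_sq_le_sq _ S.Q0pos.le
      nlinarith [sq_nonneg (px ψ x (η x))]
    linarith
  · intro x
    left
    have := S.w_nonneg (x := x) le_rfl (S.sol.eta_pos x).le
    have := mul_pos hγ S.hd
    linarith
  · intro x y h0 h1
    rw [lap_cs S.sm.dpy, S.harm_y h0 h1]; simp

/-- `|ψ_x| ≤ √(s² + 2γ)` in the fluid (one side is enough). -/
lemma Setup.px_le (S : Setup γ s d r ψ η) {x y : ℝ} (h0 : 0 ≤ y) (h1 : y ≤ η x) :
    px ψ x y ≤ s + γ * d := by
  have hγ : 0 < γ := by linarith [S.hγ]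
  have := S.minprinc (S.sm.dpx.const_sub' (s + γ * d) 0) (m := 0) ?_ ?_ ?_ ?_ h0 h1
  · linarith
  · intro ε hε
    obtain ⟨X, hX⟩ := S.asym ε hε
    refine ⟨X, fun x y hx h0 h1 => ?_⟩
    have a := (hX x hx).2 y ⟨h0, h1⟩
    have b := le_abs_self (px ψ x y)
    have c := abs_nonneg (py ψ x y - (γ * y + s))
    have := S.Q0pos
    linarith
  · intro x
    have h1 := S.top_sq x
    have h2 : px ψ x (η x) ≤ s + γ * d := by
      apply le_of_sq_le_sq _ S.Q0pos.le
      nlinarith [sq_nonneg (py ψ x (η x))]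
    linarith
  · intro x
    left
    rw [S.px_bot]
    linarith [S.Q0pos]
  · intro x y h0 h1
    rw [lap_cs S.sm.dpx, S.harm_x h0 h1]; simp

end setup

lemma col_mono {f f' : ℝ → ℝ} {a b : ℝ} (hf : ∀ t ∈ Icc a b, HasDerivAt f (f' t) t) (hab : a ≤ b)
    (h : ∀ t, a < t → t < b → 0 ≤ f' t) : f a ≤ f b := by
  have : MonotoneOn f (Icc a b) := by
    apply monotoneOn_of_deriv_nonneg (convex_Icc a b)
    · exact fun t ht => (hf t ht).continuousAt.continuousWithinAt
    · intro t ht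
      rw [interior_Icc] at ht
      exact (hf t ⟨ht.1.le, ht.2.le⟩).differentiableAt.differentiableWithinAt
    · intro t ht
      rw [interior_Icc] at ht
      rw [(hf t ⟨ht.1.le, ht.2.le⟩).deriv]
      exact h t ht.1 ht.2
  exact this ⟨le_rfl, hab⟩ ⟨hab, le_rfl⟩ hab

section setup3
variable {γ s d r : ℝ} {ψ : ℝ → ℝ → ℝ} {η : ℝ → ℝ}

lemma Setup.eta_even (S : Setup γ s d r ψ η) (x : ℝ) : η (-x) = η x :=
  le_antisymm (S.eta_mono x (-x) (by simp)) (S.eta_mono (-x) x (by simp))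

lemma Setup.px_odd (S : Setup γ s d r ψ η) (x y : ℝ) : px ψ (-x) y = - px ψ x y := by
  have h := S.sm.hx x y
  have h2 : HasDerivAt (fun t => ψ (-t) y) (px ψ (-x) y * (-1)) x :=
    (S.sm.hx (-x) y).comp x (hasDerivAt_neg x)
  have he : (fun t => ψ (-t) y) = fun t => ψ t y := funext fun t => S.psi_even t y
  rw [he] at h2
  have := h.unique h2
  linarith

lemma Setup.px_ge (S : Setup γ s d r ψ η) {x y : ℝ} (h0 : 0 ≤ y) (h1 : y ≤ η x) :
    -(s + γ * d) ≤ px ψ x y := by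
  have := S.px_le (x := -x) h0 (by rw [S.eta_even]; exact h1)
  rw [S.px_odd] at this
  linarith

lemma Setup.psi_nonneg (S : Setup γ s d r ψ η) {x y : ℝ} (h0 : 0 ≤ y) (h1 : y ≤ η x) :
    0 ≤ ψ x y := by
  have := col_mono (fun t _ => S.sm.hy x t) h0
    (fun t a b => S.py_nonneg a.le (b.le.trans h1))
  rwa [S.sol.bottom_val] at this

lemma Setup.psi_le_one (S : Setup γ s d r ψ η) {x y : ℝ} (h0 : 0 ≤ y) (h1 : y ≤ η x) :
    ψ x y ≤ 1 := by
  have := col_mono (fun t _ => S.sm.hy x t) h1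
    (fun t a b => S.py_nonneg (h0.trans a.le) b.le)
  rwa [S.sol.surface_val] at this

lemma Setup.psi_le (S : Setup γ s d r ψ η) {x y : ℝ} (h0 : 0 ≤ y) (h1 : y ≤ η x) :
    ψ x y ≤ γ * y ^ 2 / 2 + s * y := by
  have hd : ∀ t, HasDerivAt (fun t => γ * t ^ 2 / 2 + s * t - ψ x t)
      (s + γ * t - py ψ x t) t := fun t => by
    have := (((((hasDerivAt_id t).pow 2).const_mul γ).div_const 2).add
      ((hasDerivAt_id t).const_mul s)).sub (S.sm.hy x t)
    refine this.congr_deriv ?_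
    simp; ring
  have := col_mono (fun t _ => hd t) h0
    (fun t a b => S.w_nonneg a.le (b.le.trans h1))
  rw [S.sol.bottom_val] at this
  simp at this
  linarith

/-- The P-function bound. -/
lemma Setup.pfun (S : Setup γ s d r ψ η) {k : ℝ} (hk : γ / 2 < k) (hk' : k < γ) {x₀ y₀ : ℝ}
    (hy₀ : 0 ≤ y₀) (hy₀' : y₀ ≤ η x₀) :
    -(η 0 - d) ≤ px ψ x₀ y₀ ^ 2 / 2 + py ψ x₀ y₀ ^ 2 / 2 - k * ψ x₀ y₀ := by
  have hγ : 0 < γ := by linarith [S.hγ]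
  have hs := S.hs
  set A := η 0 - d with hA
  have hA0 : 0 ≤ A := by have := S.eta_ge 0; linarith
  by_contra hlt
  push Not at hlt
  set F : ℝ → ℝ → ℝ := fun x y => px ψ x y ^ 2 / 2 + py ψ x y ^ 2 / 2 - k * ψ x y with hF
  have hFc : Continuous fun p : ℝ × ℝ => F p.1 p.2 := by
    have h1 := S.sm.cont
    have h2 := S.sm.dpx.cont
    have h3 := S.sm.dpy.cont
    simp only [hF]
    fun_prop
  have hlt' : F x₀ y₀ < -A := hlt
  set e := (-A - F x₀ y₀) / 2 with he
  have hepos : 0 < e := by linarith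
  have hHpos : 0 < η 0 := S.sol.eta_pos 0
  obtain ⟨X, hX⟩ := S.asym (e / (γ * η 0 + s)) (by positivity)
  obtain ⟨x, y, -, h2, h3, h4, h5, h6, -⟩ := min_compact (u := F) hFc S.etac
    (X := max X |x₀|) (m := -A - e)
    (by
      intro x y hx h0 h1
      have a := (hX x (by rw [hx]; exact le_max_left _ _)).2 y ⟨h0, h1⟩
      set e' := e / (γ * η 0 + s) with he'
      have hee : e' * (γ * η 0 + s) = e := by rw [he']; field_simp
      have he'pos : 0 < e' := by positivity
      have b := neg_abs_le (py ψ x y - (γ * y + s))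
      have c := abs_nonneg (px ψ x y)
      have hb : γ * y + s - e' ≤ py ψ x y := by linarith
      have hb0 : 0 ≤ γ * y + s := by positivity
      have hbH : γ * y + s ≤ γ * η 0 + s := by
        have := h1.trans (S.eta_le x); gcongr
      have h7 := S.psi_le h0 h1
      have h8 := S.psi_nonneg h0 h1
      have h9 : k * ψ x y ≤ γ * (γ * y ^ 2 / 2 + s * y) := by
        apply mul_le_mul hk'.le h7 h8 hγ.le
      have h10 : (γ * y + s) * (γ * y + s - e') ≤ (γ * y + s) * py ψ x y := by gcongr
      have h11 := mul_le_mul_of_nonneg_left hbH he'pos.le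
      simp only [hF]
      nlinarith [sq_nonneg (px ψ x y), sq_nonneg (py ψ x y - (γ * y + s)), sq_nonneg s])
    (by
      intro x _ h0
      have h1 := S.sol.bernoulli x
      have h2 := S.sol.surface_val x
      have h3 := S.eta_le x
      have h4 := S.hr
      simp only [hF]
      rw [h2]
      nlinarith [sq_nonneg s])
    (le_max_right X |x₀|) hy₀ hy₀' (by linarith)
  have hdx : ∀ t, HasDerivAt (fun t => F t y)
      (px ψ t y * px (px ψ) t y + py ψ t y * px (py ψ) t y - k * px ψ t y) t := fun t => by
    have := ((((S.sm.dpx.hx t y).pow 2).div_const 2).add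
      (((S.sm.dpy.hx t y).pow 2).div_const 2)).sub ((S.sm.hx t y).const_mul k)
    refine this.congr_deriv ?_
    simp; ring
  have hdy : ∀ t, HasDerivAt (fun t => F x t)
      (px ψ x t * py (px ψ) x t + py ψ x t * py (py ψ) x t - k * py ψ x t) t := fun t => by
    have := ((((S.sm.dpx.hy x t).pow 2).div_const 2).add
      (((S.sm.dpy.hy x t).pow 2).div_const 2)).sub ((S.sm.hy x t).const_mul k)
    refine this.congr_deriv ?_
    simp; ring
  rcases h2.eq_or_lt with h0 | h0
  · subst h0
    simp only [hF] at h4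
    rw [S.sol.bottom_val] at h4
    nlinarith [sq_nonneg (px ψ x 0), sq_nonneg (py ψ x 0)]
  · have hxx := (((S.sm.dpx.hx x y).mul (S.sm.dpx.dpx.hx x y)).add
      ((S.sm.dpy.hx x y).mul (S.sm.dpy.dpx.hx x y))).sub ((S.sm.dpx.hx x y).const_mul k)
    have hyy := (((S.sm.dpx.hy x y).mul (S.sm.dpx.dpy.hy x y)).add
      ((S.sm.dpy.hy x y).mul (S.sm.dpy.dpy.hy x y))).sub ((S.sm.dpy.hy x y).const_mul k)
    obtain ⟨a1, a2⟩ := second_order hdx hxx h5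
    obtain ⟨b1, b2⟩ := second_order hdy hyy (h6 h0)
    have l0 := S.lap h0.le h3.le
    have l1 := S.harm_x h0 h3
    have l2 := S.harm_y h0 h3
    have q := S.uni x y h0 h3
    rw [S.sm.comm] at b1 b2
    generalize px (px (px ψ)) x y = u1 at *
    generalize py (py (px ψ)) x y = u2 at *
    generalize px (px (py ψ)) x y = u3 at *
    generalize py (py (py ψ)) x y = u4 at *
    generalize px (px ψ) x y = a at *
    generalize px (py ψ) x y = b at *
    generalize py (py ψ) x y = c at *
    generalize px ψ x y = p at *
    generalize py ψ x y = q' at *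
    have det : (a - k) * (c - k) = b ^ 2 := by
      have : q' * ((a - k) * (c - k) - b ^ 2) = 0 := by
        linear_combination (a - k) * b1 - b * a1
      rcases mul_eq_zero.mp this with h | h
      · exact absurd h q.ne'
      · linarith
    have hu2 : u2 = -u1 := by linarith
    have hu4 : u4 = -u3 := by linarith
    have hc : c = γ - a := by linarith
    subst hu2 hu4 hc
    nlinarith [mul_pos (sub_pos.mpr hk') (by linarith : 0 < 2 * k - γ)]

lemma Setup.crest (S : Setup γ s d r ψ η) {y : ℝ} (h0 : 0 ≤ y) (h1 : y ≤ η 0) :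
    2 * γ * ψ 0 y - 2 * (η 0 - d) ≤ py ψ 0 y ^ 2 := by
  have hγ : 0 < γ := by linarith [S.hγ]
  by_contra hlt
  push Not at hlt
  set g := 2 * γ * ψ 0 y - 2 * (η 0 - d) - py ψ 0 y ^ 2 with hg
  have hgpos : 0 < g := by linarith
  have hmin : 0 < min (g / 4) (γ / 4) := by positivity
  have h2 := S.pfun (k := γ - min (g / 4) (γ / 4)) (by linarith [min_le_right (g / 4) (γ / 4)])
    (by linarith) h0 h1
  rw [S.px_zero] at h2
  have h3 := S.psi_nonneg h0 h1
  have h4 := S.psi_le_one h0 h1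
  have h5 : min (g / 4) (γ / 4) * ψ 0 y ≤ g / 4 * 1 :=
    mul_le_mul (min_le_left _ _) h4 h3 (by positivity)
  linarith

end setup3

/-- Weak minimum principle in a rectangle with Neumann condition at the bottom. -/
lemma minrect {u : ℝ → ℝ → ℝ} (hu : Sm u) {X h : ℝ} (hh : 0 < h)
    (hside : ∀ x y, |x| = X → 0 ≤ y → y ≤ h → 0 ≤ u x y)
    (htop : ∀ x, |x| ≤ X → 0 ≤ u x h) (hbot : ∀ x, py u x 0 ≤ 0)
    (hlap : ∀ x y, |x| < X → 0 < y → y < h → px (px u) x y + py (py u) x y ≤ 0)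
    {x₀ y₀ : ℝ} (hx₀ : |x₀| ≤ X) (hy₀ : 0 ≤ y₀) (hy₀' : y₀ ≤ h) : 0 ≤ u x₀ y₀ := by
  by_contra hlt
  push Not at hlt
  set e := (- u x₀ y₀) / 4 with he
  have hepos : 0 < e := by linarith
  set δ := e / (h + h ^ 2) with hδ
  have hδpos : 0 < δ := by positivity
  have hδH : δ * (h + h ^ 2) = e := by rw [hδ]; field_simp
  set v : ℝ → ℝ → ℝ := fun x y => u x y - δ * (y + y ^ 2) with hv
  have hcv : Continuous fun p : ℝ × ℝ => v p.1 p.2 := by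
    have := hu.cont
    simp only [hv]
    fun_prop
  have hb : ∀ y, 0 ≤ y → y ≤ h → δ * (y + y ^ 2) ≤ e := fun y h0 h1 => by
    rw [← hδH]; gcongr
  obtain ⟨x, y, h1, h2, h3, h4, h5, h6, h7⟩ := min_compact (u := v) hcv
    (h := fun _ => h) continuous_const (X := X) (m := - 2 * e)
    (by
      intro x y hx h0 h1
      have := hside x y hx h0 h1
      have := hb y h0 h1
      simp only [hv]; linarith)
    (by
      intro x hx h0
      have := hb h h0 le_rfl
      have := htop x hx
      simp only [hv]; linarith)
    hx₀ hy₀ hy₀'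
    (by
      have : 0 ≤ δ * (y₀ + y₀ ^ 2) := by positivity
      simp only [hv]; linarith)
  have hdy : ∀ t, HasDerivAt (fun t => v x t) (py u x t - δ * (1 + 2 * t)) t := fun t => by
    have := (hu.hy x t).sub (((hasDerivAt_id t).add ((hasDerivAt_id t).pow 2)).const_mul δ)
    refine this.congr_deriv ?_
    simp
  rcases h2.eq_or_lt with h0 | h0
  · subst h0
    have hb1 := hbot x
    have hneg : py u x 0 - δ * (1 + 2 * 0) < 0 := by linarith
    have hsl := (hdy 0).tendsto_slope
    have hev := hsl.eventually_lt_const hneg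
    have hev2 : ∀ᶠ t in nhdsWithin (0 : ℝ) (Ioi 0), slope (fun t => v x t) 0 t < 0 :=
      hev.filter_mono (nhdsWithin_mono (0 : ℝ) (s := Ioi 0) (t := {0}ᶜ)
        (fun t (ht : 0 < t) => ht.ne'))
    obtain ⟨t, ht1, ht2, ht3⟩ := (hev2.and (h7.and self_mem_nhdsWithin)).exists
    rw [slope_def_field, sub_zero] at ht1
    have ht3' : 0 < t := ht3
    rw [div_lt_iff₀ ht3'] at ht1
    linarith
  · have hyy : HasDerivAt (fun t => py u x t - δ * (1 + 2 * t)) (py (py u) x y - 2 * δ) y := by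
      have := (hu.dpy.hy x y).sub ((((hasDerivAt_id y).const_mul 2).const_add 1).const_mul δ)
      refine this.congr_deriv ?_
      ring
    have hdx : ∀ t, HasDerivAt (fun t => v t y) (px u t y) t := fun t =>
      (hu.hx t y).sub_const _
    have a1 := second_order hdy hyy (h6 h0)
    have a2 := second_order hdx (hu.dpx.hx x y) h5
    have := hlap x y h1 h0 h3
    linarith [a1.2, a2.2]

section setup4
variable {γ s d r : ℝ} {ψ : ℝ → ℝ → ℝ} {η : ℝ → ℝ}

/-- Derivative of the flux of `ψ_x` through a vertical column. -/
lemma Setup.flux_deriv (S : Setup γ s d r ψ η) (x : ℝ) :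
    HasDerivAt (fun x => ∫ t in (0 : ℝ)..1, η x * px ψ x (η x * t))
      (γ * η x + py ψ x 0 - py ψ x (η x) * (1 + deriv η x ^ 2)) x := by
  have hK : Sm (fun x t => η x * px ψ x (η x * t)) := by
    have h1 : ContDiff ℝ (⊤ : ℕ∞) (fun p : ℝ × ℝ => px ψ p.1 p.2) := S.sm.dpx
    have h2 := S.sol.eta_smooth
    have h3 : ContDiff ℝ (⊤ : ℕ∞) (fun p : ℝ × ℝ => η p.1) := h2.comp contDiff_fst
    have h4 : ContDiff ℝ (⊤ : ℕ∞) (fun p : ℝ × ℝ => (p.1, η p.1 * p.2)) :=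
      contDiff_fst.prodMk (h3.mul contDiff_snd)
    exact h3.mul (h1.comp h4)
  refine (hK.param x).congr_deriv ?_
  have hpos := S.sol.eta_pos x
  have e1 : ∀ t, px (fun x t => η x * px ψ x (η x * t)) x t =
      deriv η x * px ψ x (η x * t) + η x * (px (px ψ) x (η x * t)
        + py (px ψ) x (η x * t) * (deriv η x * t)) := fun t => by
    have := (S.etad x).mul (S.sm.dpx.hcomp (hasDerivAt_id x) ((S.etad x).mul_const t))
    have h2 := this.deriv
    simp only [mul_one] at h2
    exact h2
  have e2 : ∀ t ∈ uIcc (0 : ℝ) 1, HasDerivAt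
      (fun t => deriv η x * t * px ψ x (η x * t) + γ * η x * t - py ψ x (η x * t))
      (px (fun x t => η x * px ψ x (η x * t)) x t) t := fun t ht => by
    rw [uIcc_of_le (by norm_num)] at ht
    have hm : HasDerivAt (fun t => η x * t) (η x) t := by
      simpa using (hasDerivAt_id t).const_mul (η x)
    have a1 := S.sm.dpx.hcomp (hasDerivAt_const t x) hm
    have a2 := S.sm.dpy.hcomp (hasDerivAt_const t x) hm
    have := ((((hasDerivAt_id t).const_mul (deriv η x)).mul a1).add
      ((hasDerivAt_id t).const_mul (γ * η x))).sub a2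
    refine this.congr_deriv ?_
    rw [e1]
    have hl := S.lap (x := x) (y := η x * t) (mul_nonneg hpos.le ht.1)
      (mul_le_of_le_one_right hpos.le ht.2)
    simp only [id]
    linear_combination -(η x) * hl
  rw [intervalIntegral.integral_eq_sub_of_hasDerivAt e2
    ((hK.dpx.cy x).intervalIntegrable _ _)]
  have := S.top x
  simp only [mul_one, mul_zero, zero_mul]
  linear_combination (deriv η x) * this

lemma Setup.flux_ge (S : Setup γ s d r ψ η) (x : ℝ) :
    -(η x * (s + γ * d)) ≤ ∫ t in (0 : ℝ)..1, η x * px ψ x (η x * t) := by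
  have hpos := S.sol.eta_pos x
  have hc : Continuous fun t => η x * px ψ x (η x * t) := by
    have := (S.sm.dpx.cy x).comp (continuous_const.mul continuous_id : Continuous fun t => η x * t)
    exact continuous_const.mul this
  have := intervalIntegral.integral_mono_on (a := 0) (b := 1) (by norm_num)
    (f := fun _ => -(η x * (s + γ * d))) (by simp)
    (hc.intervalIntegrable (μ := MeasureTheory.volume) 0 1)
    (fun t ht => by
      have := S.px_ge (x := x) (y := η x * t) (mul_nonneg hpos.le ht.1)
        (mul_le_of_le_one_right hpos.le ht.2)
      have := mul_le_mul_of_nonneg_left this hpos.le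
      linarith)
  simpa using this

/-- Main estimate giving a lower bound of the width of the wave. -/
lemma Setup.width (S : Setup γ s d r ψ η) {x₁ : ℝ} (hx₁ : 0 ≤ x₁) :
    (η 0 - η x₁) * (2 * r - η x₁ - η 0) / (s + γ * d) - η x₁ * (s + γ * d)
      ≤ (γ * η 0 + s) * x₁ := by
  have hQ := S.Q0pos
  have hγ : 0 < γ := by linarith [S.hγ]
  set Q := s + γ * d with hQd
  set N : ℝ → ℝ := fun x => ∫ t in (0 : ℝ)..1, η x * px ψ x (η x * t) with hN
  have hd : ∀ x, HasDerivAt (fun x => (γ * η 0 + s) * x - (r - η x) ^ 2 / Q - N x)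
      ((γ * η 0 + s) + 2 * (r - η x) * deriv η x / Q
        - (γ * η x + py ψ x 0 - py ψ x (η x) * (1 + deriv η x ^ 2))) x := fun x => by
    have := (((hasDerivAt_id x).const_mul (γ * η 0 + s)).sub
      ((((S.etad x).const_sub r).pow 2).div_const Q)).sub (S.flux_deriv x)
    refine this.congr_deriv ?_
    simp; ring
  have hm := col_mono (fun x _ => hd x) hx₁ (fun x _ _ => by
    have hp := S.sol.eta_pos x
    have b := S.sol.bernoulli x
    have t := S.top x
    have p0 := S.py_nonneg (x := x) hp.le le_rfl
    have p1 := S.px_le (x := x) hp.le le_rfl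
    have w0 := S.w_nonneg (x := x) le_rfl hp.le
    have l := mul_le_mul_of_nonneg_left (S.eta_le x) hγ.le
    have key : -(py ψ x (η x) * (1 + deriv η x ^ 2)) ≤ 2 * (r - η x) * deriv η x / Q := by
      rw [le_div_iff₀ hQ]
      have hx : px ψ x (η x) = - (py ψ x (η x) * deriv η x) := by linarith
      have h2 : 2 * (r - η x) = py ψ x (η x) ^ 2 * (1 + deriv η x ^ 2) := by
        rw [hx] at b
        linear_combination -2 * b
      rw [h2]
      rw [hx] at p1
      have : 0 ≤ py ψ x (η x) * (1 + deriv η x ^ 2) := by positivity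
      have := mul_le_mul_of_nonneg_left p1 this
      linarith
    linarith)
  have hN0 : N 0 = 0 := by
    simp only [hN, S.px_zero]; simp
  have hN1 := S.flux_ge x₁
  have hN1' : -(η x₁ * Q) ≤ N x₁ := hN1
  rw [hN0] at hm
  have e : (η 0 - η x₁) * (2 * r - η x₁ - η 0) / Q = (r - η x₁) ^ 2 / Q - (r - η 0) ^ 2 / Q := by
    rw [← sub_div]; congr 1; ring
  rw [e]
  simp at hm
  linarith

end setup4

section barrier

lemma Sm.barrier {u : ℝ → ℝ → ℝ} (h : Sm u) (b κ : ℝ) :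
    Sm (fun x y => u x y - b * (Real.cos (κ * x) * Real.cosh (κ * y))) := by
  unfold Sm at *
  have h1 : ContDiff ℝ (⊤ : ℕ∞) (fun p : ℝ × ℝ => Real.cos (κ * p.1)) := by fun_prop
  have h2 : ContDiff ℝ (⊤ : ℕ∞) (fun p : ℝ × ℝ => Real.cosh (κ * p.2)) :=
    Real.contDiff_cosh.comp (by fun_prop)
  exact h.sub (contDiff_const.mul (h1.mul h2))

lemma py_barrier {u : ℝ → ℝ → ℝ} (h : Sm u) (b κ x y : ℝ) :
    py (fun x y => u x y - b * (Real.cos (κ * x) * Real.cosh (κ * y))) x y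
      = py u x y - b * (Real.cos (κ * x) * (Real.sinh (κ * y) * κ)) := by
  have hm : HasDerivAt (fun t => κ * t) κ y := by simpa using (hasDerivAt_id y).const_mul κ
  exact ((h.hy x y).sub ((hm.cosh.const_mul (Real.cos (κ * x))).const_mul b)).deriv

lemma lap_barrier {u : ℝ → ℝ → ℝ} (h : Sm u) (b κ x y : ℝ) :
    px (px (fun x y => u x y - b * (Real.cos (κ * x) * Real.cosh (κ * y)))) x y
      + py (py (fun x y => u x y - b * (Real.cos (κ * x) * Real.cosh (κ * y)))) x y
      = px (px u) x y + py (py u) x y := by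
  have hm : ∀ y, HasDerivAt (fun t => κ * t) κ y := fun y => by
    simpa using (hasDerivAt_id y).const_mul κ
  have e1 : px (fun x y => u x y - b * (Real.cos (κ * x) * Real.cosh (κ * y)))
      = fun x y => px u x y - b * (-Real.sin (κ * x) * κ * Real.cosh (κ * y)) := by
    funext x y
    exact ((h.hx x y).sub (((hm x).cos.mul_const (Real.cosh (κ * y))).const_mul b)).deriv
  have e2 : py (fun x y => u x y - b * (Real.cos (κ * x) * Real.cosh (κ * y)))
      = fun x y => py u x y - b * (Real.cos (κ * x) * (Real.sinh (κ * y) * κ)) := by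
    funext x y; exact py_barrier h b κ x y
  have a1 : px (fun x y => px u x y - b * (-Real.sin (κ * x) * κ * Real.cosh (κ * y))) x y
      = px (px u) x y - b * (-(Real.cos (κ * x) * κ) * κ * Real.cosh (κ * y)) :=
    ((h.dpx.hx x y).sub
      (((((hm x).sin.neg).mul_const κ).mul_const (Real.cosh (κ * y))).const_mul b)).deriv
  have a2 : py (fun x y => py u x y - b * (Real.cos (κ * x) * (Real.sinh (κ * y) * κ))) x y
      = py (py u) x y - b * (Real.cos (κ * x) * (Real.cosh (κ * y) * κ * κ)) :=
    ((h.dpy.hy x y).sub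
      (((((hm y).sinh).mul_const κ).const_mul (Real.cos (κ * x))).const_mul b)).deriv
  rw [e1, e2, a1, a2]; ring

end barrier

section setup5
variable {γ s d r : ℝ} {ψ : ℝ → ℝ → ℝ} {η : ℝ → ℝ}

set_option maxHeartbeats 2000000 in
/-- A priori bound of the amplitude. -/
lemma Setup.apriori (S : Setup γ s d r ψ η) (hγ2 : 2 * Real.cosh (30 * π) < γ) :
    η 0 - d ≤ γ / 10 := by
  by_contra hA
  push Not at hA
  have hγ1 := S.hγ
  have hγ : 0 < γ := by linarith
  have hs := S.hs
  have hd := S.hd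
  have hsγ := S.hsγ
  have hQ := S.Q0pos
  have hQ2 := S.Q0
  set H := η 0 with hH
  set g := √γ with hg
  have hgpos : 0 < g := Real.sqrt_pos.mpr hγ
  have hgg : g * g = γ := Real.mul_self_sqrt hγ.le
  have hg30 : 30 < g := by
    by_contra h; push Not at h; nlinarith
  have hs1 : s ≤ 1 / 100 := by nlinarith
  have hQle : s + γ * d ≤ 3 / 2 * g := by
    apply le_of_sq_le_sq _ (by positivity)
    rw [hQ2]; nlinarith
  set Q := s + γ * d with hQd
  set y0 := 3 / g with hy0
  have hy0g : y0 * g = 3 := by rw [hy0]; field_simp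
  have hy0pos : 0 < y0 := by positivity
  have hy0s : y0 ≤ 1 / 10 := by rw [hy0, div_le_iff₀ hgpos]; linarith
  have hdy0 : d < y0 := by
    have : g * (g * d) ≤ g * (3 / 2) := by rw [← mul_assoc, hgg]; linarith
    have h2 := le_of_mul_le_mul_left this hgpos
    by_contra h3
    push Not at h3
    have := mul_le_mul_of_nonneg_left h3 hgpos.le
    linarith
  -- the width
  obtain ⟨X, hX⟩ := S.asym (y0 - d) (by linarith)
  set X1 := max X 0 with hX1
  have hX10 : 0 ≤ X1 := le_max_right _ _
  have hηX1 : η X1 ≤ y0 := by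
    have := (hX X1 (by rw [abs_of_nonneg hX10]; exact le_max_left _ _)).1
    have := le_abs_self (η X1 - d)
    linarith
  obtain ⟨x₁, hx₁, hx₁e⟩ := intermediate_value_Icc' hX10 S.etac.continuousOn
    (show y0 ∈ Icc (η X1) (η 0) from ⟨hηX1, by linarith⟩)
  have hw := S.width hx₁.1
  rw [hx₁e] at hw
  have hrH : H ≤ r := by
    have := S.sol.bernoulli 0
    nlinarith [sq_nonneg (px ψ 0 (η 0)), sq_nonneg (py ψ 0 (η 0))]
  have hrγ : γ ≤ r := by have := S.hr; nlinarith
  have hH100 : 100 < H := by linarith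
  have h1 : H * γ / 4 ≤ (H - y0) * (2 * r - y0 - H) := by
    have a : H / 2 ≤ H - y0 := by linarith
    have b : γ / 2 ≤ 2 * r - y0 - H := by linarith
    have := mul_le_mul a b (by positivity) (by linarith)
    linarith
  have h2 : H * g / 6 ≤ (H - y0) * (2 * r - y0 - H) / Q := by
    rw [le_div_iff₀ hQ]
    have : H * g / 6 * Q ≤ H * g / 6 * (3 / 2 * g) := by gcongr
    have e : H * g / 6 * (3 / 2 * g) = H * γ / 4 := by rw [← hgg]; ring
    linarith
  have h3 : y0 * Q ≤ 9 / 2 := by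
    have : y0 * Q ≤ y0 * (3 / 2 * g) := by gcongr
    linarith
  have h4 : H * g / 10 ≤ (γ * H + s) * x₁ := by
    have : 100 * 30 ≤ H * g := by gcongr
    linarith
  set W := 1 / (20 * g) with hW
  have hWpos : 0 < W := by positivity
  have hWg : W * g = 1 / 20 := by rw [hW]; field_simp
  have hWx : W ≤ x₁ := by
    by_contra hlt
    push Not at hlt
    have h5 : (γ * H + s) * x₁ ≤ (γ * H + γ * H) * x₁ := by
      have : s ≤ γ * H := by nlinarith
      have := hx₁.1
      gcongr
    have h6 : (γ * H + γ * H) * x₁ < (γ * H + γ * H) * W := by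
      have : 0 < γ * H + γ * H := by positivity
      gcongr
    have e : (γ * H + γ * H) * W = H * g / 10 := by
      rw [← hgg]; linear_combination 2 * g * H * hWg
    linarith
  have hin : ∀ x, |x| ≤ W → y0 ≤ η x := fun x hx => by
    have := S.eta_mono x x₁ (by rw [abs_of_nonneg hx₁.1]; linarith)
    linarith
  -- comparison
  set κ := 10 * π * g with hκ
  have hκW : κ * W = π / 2 := by
    rw [hκ]; linear_combination 10 * π * hWg
  have hκy : κ * y0 = 30 * π := by
    rw [hκ]; linear_combination 10 * π * hy0g
  have hκpos : 0 < κ := by positivity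
  have hCpos := Real.cosh_pos (30 * π)
  set b := g / Real.cosh (30 * π) with hb
  have hbpos : 0 < b := by positivity
  have hbC : b * Real.cosh (30 * π) = g := by rw [hb]; field_simp
  have hu := (S.sm.dpy.const_sub' s γ).barrier b κ
  have hfin := minrect hu (X := W) (h := y0) hy0pos
    (by
      intro x y hx h0 h1
      have hc : Real.cos (κ * x) = 0 := by
        rcases abs_cases x with ⟨hx', _⟩ | ⟨hx', _⟩
        · rw [hx'] at hx; rw [hx, hκW, Real.cos_pi_div_two]
        · have : κ * x = -(π / 2) := by rw [← hκW, ← hx, hx']; ring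
          rw [this, Real.cos_neg, Real.cos_pi_div_two]
      rw [hc]
      have := S.w_nonneg h0 (h1.trans (hin x hx.le))
      linarith)
    (by
      intro x hx
      rw [hκy]
      have h1 := S.py_le hy0pos.le (hin x hx)
      have h2 : Real.cos (κ * x) * (b * Real.cosh (30 * π)) ≤ 1 * (b * Real.cosh (30 * π)) :=
        mul_le_mul_of_nonneg_right (Real.cos_le_one _) (by positivity)
      have h3 : γ * y0 = 3 * g := by rw [← hgg]; linear_combination g * hy0g
      rw [one_mul, hbC] at h2
      rw [h3]
      nlinarith)
    (by
      intro x
      rw [py_barrier (S.sm.dpy.const_sub' s γ), py_cs S.sm.dpy, S.pyy_bot]; simp)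
    (by
      intro x y hx h0 h1
      rw [lap_barrier (S.sm.dpy.const_sub' s γ), lap_cs S.sm.dpy,
        S.harm_y h0 (h1.trans_le (hin x hx.le))]; simp)
    (x₀ := 0) (y₀ := 0) (by simpa using hWpos.le) le_rfl hy0pos.le
  simp only [mul_zero, Real.cos_zero, Real.cosh_zero, mul_one, add_zero] at hfin
  have hp := S.py_nonneg (x := 0) le_rfl (S.sol.eta_pos 0).le
  have hbs : b ≤ s := by linarith
  have : g ≤ s * Real.cosh (30 * π) := by rw [← hbC]; gcongr
  have h7 : s * (2 * Real.cosh (30 * π)) ≤ s * γ := by gcongr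
  linarith

end setup5

section complexpart

lemma cauchy_riemann {U V : ℝ → ℝ → ℝ} (hU : Sm U) (hV : Sm V) {z : ℂ}
    (h1 : py V z.re z.im = px U z.re z.im) (h2 : py U z.re z.im = - px V z.re z.im) :
    HasDerivAt (fun z : ℂ => (U z.re z.im : ℂ) + V z.re z.im * Complex.I)
      ((px U z.re z.im : ℂ) + px V z.re z.im * Complex.I) z := by
  have key : ∀ {u : ℝ → ℝ → ℝ}, Sm u → HasFDerivAt (fun z : ℂ => (u z.re z.im : ℂ))
      (Complex.ofRealCLM.comp ((fderiv ℝ (fun p : ℝ × ℝ => u p.1 p.2) (z.re, z.im)).comp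
        (Complex.reCLM.prod Complex.imCLM))) z := by
    intro u hu
    have a : HasFDerivAt (fun z : ℂ => (z.re, z.im)) (Complex.reCLM.prod Complex.imCLM) z :=
      (Complex.reCLM.prod Complex.imCLM).hasFDerivAt
    have b := (hu.fd (z.re, z.im)).comp z a
    exact (Complex.ofRealCLM.hasFDerivAt).comp z b
  have val : ∀ {u : ℝ → ℝ → ℝ}, Sm u → ∀ a b : ℝ,
      fderiv ℝ (fun p : ℝ × ℝ => u p.1 p.2) (z.re, z.im) (a, b)
        = px u z.re z.im * a + py u z.re z.im * b := by
    intro u hu a b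
    rw [hu.px_eq, hu.py_eq]
    have : ((a, b) : ℝ × ℝ) = a • ((1 : ℝ), (0 : ℝ)) + b • ((0 : ℝ), (1 : ℝ)) := by
      ext <;> simp
    rw [this, map_add, map_smul, map_smul]
    simp [mul_comm]
  have h3 := (key hU).add ((key hV).mul_const Complex.I)
  rw [hasDerivAt_iff_hasFDerivAt]
  refine hasFDerivAt_of_restrictScalars ℝ h3 ?_
  ext w
  apply Complex.ext
  · simp [val hU, val hV, h1, h2]
    ring
  · simp [val hU, val hV, h1, h2]
    ring

variable {γ s d r : ℝ} {ψ : ℝ → ℝ → ℝ} {η : ℝ → ℝ}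

/-- The Harnack inequality for `s + γ y - ψ_y` below the crest. -/
lemma Setup.harn (S : Setup γ s d r ψ η) {y : ℝ} (h0 : 0 ≤ y) (h1 : y ≤ d / 2) :
    s + γ * y - py ψ 0 y ≤ 3 * s := by
  have hd := S.hd
  set U : ℝ → ℝ → ℝ := fun x y => s + γ * y - py ψ x y with hU
  set V : ℝ → ℝ → ℝ := fun x y => 0 + 0 * y - px ψ x y with hV
  have sU : Sm U := S.sm.dpy.const_sub' s γ
  have sV : Sm V := S.sm.dpx.const_sub' 0 0
  set F : ℂ → ℂ := fun z => (U z.re z.im : ℂ) + V z.re z.im * Complex.I with hF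
  set G : ℂ → ℂ := fun z => (starRingEnd ℂ) (F ((starRingEnd ℂ) z)) with hG
  have dF : ∀ z : ℂ, 0 ≤ z.im → z.im ≤ d →
      HasDerivAt F ((px U z.re z.im : ℂ) + px V z.re z.im * Complex.I) z := by
    intro z hz1 hz2
    refine cauchy_riemann sU sV ?_ ?_
    · rw [hU, hV, py_cs S.sm.dpx, px_cs S.sm.dpy, S.sm.comm]; ring
    · rw [hU, hV, py_cs S.sm.dpy, px_cs S.sm.dpx]
      have := S.lap (x := z.re) hz1 (hz2.trans (S.eta_ge _))
      linarith
  have dG : ∀ z : ℂ, z.im ≤ 0 → -d ≤ z.im →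
      HasDerivAt G ((starRingEnd ℂ) ((px U z.re (-z.im) : ℂ) + px V z.re (-z.im) * Complex.I)) z := by
    intro z hz1 hz2
    have := dF ((starRingEnd ℂ) z) (by simpa using hz1) (by simp; linarith)
    have h2 := this.conj_conj
    simp only [Complex.conj_conj, Complex.conj_re, Complex.conj_im] at h2
    exact h2
  have FG : ∀ z : ℂ, z.im = 0 → F z = G z := by
    intro z hz
    simp only [hG, hF, Complex.conj_re, Complex.conj_im, hz, neg_zero]
    have : V z.re 0 = 0 := by simp [hV, S.px_bot]
    rw [this]; simp
  set f : ℂ → ℂ := fun z => if 0 ≤ z.im then F z else G z with hf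
  have him : ∀ z ∈ Metric.ball (0 : ℂ) d, |z.im| < d := fun z hz => by
    rw [mem_ball_zero_iff] at hz
    exact (Complex.abs_im_le_norm z).trans_lt hz
  have hdiff : DifferentiableOn ℂ f (Metric.ball 0 d) := by
    intro z hz
    have hzi := abs_lt.mp (him z hz)
    apply DifferentiableAt.differentiableWithinAt
    rcases lt_trichotomy z.im 0 with hlt | heq | hgt
    · have hev : f =ᶠ[nhds z] G := by
        filter_upwards [Complex.continuous_im.continuousAt.eventually_lt_const hlt] with w hw
        simp only [hf]; rw [if_neg (not_le.mpr hw)]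
      exact ((dG z hlt.le hzi.1.le).congr_of_eventuallyEq hev).differentiableAt
    · have a := dF z heq.ge (by rw [heq]; exact hd.le)
      have b := dG z heq.le (by rw [heq]; linarith)
      have hvx : px V z.re 0 = 0 := by
        rw [hV, px_cs S.sm.dpx, S.pxx_bot]; simp
      rw [heq, hvx] at a
      rw [heq, neg_zero, hvx] at b
      simp only [Complex.ofReal_zero, zero_mul, add_zero, Complex.conj_ofReal] at a b
      have fz : f z = F z := by simp only [hf]; rw [if_pos heq.ge]
      have a' : HasDerivWithinAt f (px U z.re 0 : ℂ) {w | 0 ≤ w.im} z :=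
        a.hasDerivWithinAt.congr (fun w (hw : 0 ≤ w.im) => by simp only [hf]; rw [if_pos hw]) fz
      have b' : HasDerivWithinAt f (px U z.re 0 : ℂ) {w | w.im ≤ 0} z := by
        refine b.hasDerivWithinAt.congr (fun w (hw : w.im ≤ 0) => ?_) (by rw [fz, FG z heq])
        rcases hw.eq_or_lt with h | h
        · simp only [hf]; rw [if_pos h.ge, FG w h]
        · simp only [hf]; rw [if_neg (not_le.mpr h)]
      have c := a'.union b'
      have hu : ({w : ℂ | 0 ≤ w.im} ∪ {w | w.im ≤ 0}) = univ := by
        ext w; simpa using le_total 0 w.im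
      rw [hu, hasDerivWithinAt_univ] at c
      exact c.differentiableAt
    · have hev : f =ᶠ[nhds z] F := by
        filter_upwards [Complex.continuous_im.continuousAt.eventually_const_lt hgt] with w hw
        simp only [hf]; rw [if_pos (le_of_lt hw)]
      exact ((dF z hgt.le hzi.2.le).congr_of_eventuallyEq hev).differentiableAt
  have hFre : ∀ z, (F z).re = U z.re z.im := fun z => by simp [hF]
  have hGre : ∀ z, (G z).re = U z.re (-z.im) := fun z => by simp [hG, hF]
  have hpos : ∀ z ∈ Metric.ball (0 : ℂ) d, 0 ≤ (f z).re := by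
    intro z hz
    have hzi := abs_lt.mp (him z hz)
    simp only [hf]
    split_ifs with h
    · rw [hFre]; exact S.w_nonneg h (hzi.2.le.trans (S.eta_ge _))
    · rw [hGre]
      exact S.w_nonneg (by linarith) (by linarith [S.eta_ge z.re])
  have hf0 : f 0 = ((U 0 0 : ℝ) : ℂ) := by
    simp [hf, hF, hV, S.px_bot]
  have hfin := harnack hd hdiff hpos hf0 (z := (y : ℂ) * Complex.I) (by
    simpa [abs_of_nonneg h0] using h1)
  have hfy : (f ((y : ℂ) * Complex.I)).re = s + γ * y - py ψ 0 y := by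
    simp only [hf]
    rw [if_pos (by simpa using h0), hFre]
    simp [hU]
  rw [hfy] at hfin
  have hp := S.py_nonneg (x := 0) le_rfl (S.sol.eta_pos 0).le
  simp only [hU] at hfin
  linarith

/-- Lower bound of `ψ` below the crest. -/
lemma Setup.psi_low (S : Setup γ s d r ψ η) :
    γ * (d / 2) ^ 2 / 2 - 2 * s * (d / 2) ≤ ψ 0 (d / 2) := by
  have hd := S.hd
  have hD : ∀ t, HasDerivAt (fun t => ψ 0 t - (γ * t ^ 2 / 2 - 2 * s * t))
      (py ψ 0 t - (γ * t - 2 * s)) t := fun t => by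
    have := (S.sm.hy 0 t).sub (((((hasDerivAt_id t).pow 2).const_mul γ).div_const 2).sub
      ((hasDerivAt_id t).const_mul (2 * s)))
    refine this.congr_deriv ?_
    simp; ring
  have := col_mono (fun t _ => hD t) (by linarith : (0 : ℝ) ≤ d / 2)
    (fun t a b => by linarith [S.harn a.le b.le])
  rw [S.sol.bottom_val] at this
  simp at this
  linarith

end complexpart

section final
variable {γ s d r : ℝ} {ψ : ℝ → ℝ → ℝ} {η : ℝ → ℝ}

lemma Setup.amplitude (S : Setup γ s d r ψ η) (hγ2 : 2 * Real.cosh (30 * π) < γ) :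
    η 0 - d ≤ 20 / γ ^ 2 := by
  have hA := S.apriori hγ2
  have hγ1 := S.hγ
  have hγ : 0 < γ := by linarith
  have hs := S.hs
  have hd := S.hd
  have hsγ := S.hsγ
  have hQ := S.Q0pos
  have hQ2 := S.Q0
  have hdq := S.hdq
  have hge := S.eta_ge 0
  have hlow := S.psi_low
  set A := η 0 - d with hAd
  have hA0 : 0 ≤ A := by linarith
  have hd1 : d ≤ 1 / 10 := by
    by_contra h; push Not at h; nlinarith
  set a := γ * (d / 2) with ha
  have hapos : 0 < a := by positivity
  have ha2 : a ^ 2 = γ / 2 - s * γ * d / 2 := by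
    rw [ha]; linear_combination γ / 2 * hdq
  have hsgd : s * γ * d ≤ 2 * d := by gcongr
  have hsgd0 : 0 < s * γ * d := by positivity
  have hsa : 4 * s * a = 2 * (s * γ * d) := by rw [ha]; ring
  set b := 4 * s * a + 2 * A with hb
  have hb0 : 0 ≤ b := by positivity
  have hba : b ≤ a ^ 2 := by rw [ha2, hb, hsa]; linarith
  have ha1 : 2 ≤ a := by
    by_contra h; push Not at h; nlinarith
  have hψ1 : a ^ 2 - b ≤ 2 * γ * ψ 0 (d / 2) - 2 * A := by
    have := mul_le_mul_of_nonneg_left hlow (by positivity : 0 ≤ 2 * γ)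
    have e : 2 * γ * (γ * (d / 2) ^ 2 / 2 - 2 * s * (d / 2)) = a ^ 2 - 4 * s * a := by
      rw [ha]; ring
    linarith
  have hab : 0 < a ^ 2 - b := by rw [hb, hsa, ha2]; linarith
  have hpos : ∀ t ∈ Icc (d / 2) (η 0), 0 < 2 * γ * ψ 0 t - 2 * A := by
    intro t ht
    have := col_mono (fun t _ => S.sm.hy 0 t) ht.1
      (fun u h1 h2 => S.py_nonneg (by linarith) (by linarith [ht.2]))
    have := mul_le_mul_of_nonneg_left this (by positivity : 0 ≤ 2 * γ)
    linarith
  have hD : ∀ t ∈ Icc (d / 2) (η 0), HasDerivAt (fun t => √(2 * γ * ψ 0 t - 2 * A) - γ * t)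
      (2 * γ * py ψ 0 t / (2 * √(2 * γ * ψ 0 t - 2 * A)) - γ) t := by
    intro t ht
    have h1 := (((S.sm.hy 0 t).const_mul (2 * γ)).sub_const (2 * A)).sqrt (hpos t ht).ne'
    have := h1.sub ((hasDerivAt_id t).const_mul γ)
    refine this.congr_deriv ?_
    simp
  have hm := col_mono hD (by linarith) (fun t h1 h2 => by
    have hp := hpos t ⟨h1.le, h2.le⟩
    have hsq : 0 < √(2 * γ * ψ 0 t - 2 * A) := Real.sqrt_pos.mpr hp
    have hc := S.crest (y := t) (by linarith) h2.le
    have hy := S.py_nonneg (x := 0) (y := t) (by linarith) h2.le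
    have hle : √(2 * γ * ψ 0 t - 2 * A) ≤ py ψ 0 t := by
      rw [Real.sqrt_le_left hy]; exact hc
    rw [sub_nonneg, le_div_iff₀ (by positivity)]
    nlinarith)
  rw [S.sol.surface_val] at hm
  have hlo : a - b / a ≤ √(2 * γ * ψ 0 (d / 2) - 2 * A) := by
    apply Real.le_sqrt_of_sq_le
    refine le_trans ?_ hψ1
    have e : (a - b / a) ^ 2 = a ^ 2 - b - b * (1 - b / a ^ 2) := by
      field_simp
    have : b / a ^ 2 ≤ 1 := by rw [div_le_one (by positivity)]; exact hba
    have := mul_nonneg hb0 (sub_nonneg.mpr this)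
    linarith
  have hhi : √(2 * γ * 1 - 2 * A) ≤ s + γ * d := by
    rw [Real.sqrt_le_left hQ.le, hQ2]
    nlinarith [sq_nonneg s]
  have hba2 : b / a ≤ 4 * s + A := by
    rw [div_le_iff₀ hapos, hb]; nlinarith
  have e2 : γ * η 0 = γ * A + 2 * a := by rw [hAd, ha]; ring
  have e3 : γ * d = 2 * a := by rw [ha]; ring
  have hmain : γ * A ≤ 5 * s + A := by linarith
  rw [le_div_iff₀ (by positivity)]
  have h5 : (γ - 1) * A * γ ≤ 10 := by
    have : (γ - 1) * A * γ ≤ 5 * s * γ := by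
      apply mul_le_mul_of_nonneg_right _ hγ.le; linarith
    linarith
  have h6 : 0 ≤ A * γ := by positivity
  nlinarith

end final

/-- Theorem 1.1 (iii), solitary case: for large adverse vorticity, unidirectional
solitary waves with `R(s_c) < r ≤ R(0)` have small amplitude, `η̂ - η̌ ≤ C γ⁻²`. -/
theorem solitary_small_amplitude :
    ∃ C > (0 : ℝ), ∃ γ₀ > (0 : ℝ), ∀ γ > γ₀, ∀ sc : ℝ, IsCrit γ sc →
      ∀ (ψ : ℝ → ℝ → ℝ) (η : ℝ → ℝ) (r : ℝ),
        SolitaryWave γ sc ψ η r → Unidirectional ψ η →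
        bernR γ sc < r → r ≤ bernR γ 0 →
        η 0 - (⨅ x : ℝ, η x) ≤ C / γ ^ 2 := by
  refine ⟨20, by norm_num, 1000 + 2 * Real.cosh (30 * π),
    by have := Real.cosh_pos (30 * π); positivity, ?_⟩
  intro γ hγ₀ sc hsc ψ η r hw huni _ hr
  have hC := Real.cosh_pos (30 * π)
  have hγ1 : 1000 < γ := by linarith
  have hγ : 0 < γ := by linarith
  obtain ⟨s, hs, hrs, hasym⟩ := hw.asymptotic
  have hs0 : 0 < s := hsc.1.trans hs
  set q := √(s ^ 2 + 2 * γ) with hq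
  have hqq : q ^ 2 = s ^ 2 + 2 * γ := Real.sq_sqrt (by positivity)
  have hqs : s < q := Real.lt_sqrt_of_sq_lt (by linarith)
  have hdef : lamDepth γ s = (-s + q) / γ := rfl
  set d := lamDepth γ s with hd
  have hγd : γ * d = q - s := by rw [hdef]; field_simp; ring
  have hd0 : 0 < d := by rw [hdef]; apply div_pos _ hγ; linarith
  have hdq : γ * d ^ 2 / 2 + s * d = 1 := by
    have h1 : γ * (γ * d ^ 2 / 2 + s * d) = γ * 1 := by
      linear_combination (γ * d + q - s) / 2 * hγd + s * hγd + hqq / 2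
    exact mul_left_cancel₀ hγ.ne' h1
  have hrr : r = s ^ 2 / 2 + γ + d := by rw [← hrs]; rfl
  have hsγ : s * γ ≤ 2 := by
    have h0 : bernR γ 0 = γ + √(2 * γ) / γ := by simp [bernR, lamDepth]
    have h1 : √(2 * γ) ≤ q := Real.sqrt_le_sqrt (by nlinarith [sq_nonneg s])
    rw [hrr, h0] at hr
    have h2 : √(2 * γ) / γ ≤ q / γ := by gcongr
    have h3 : d = q / γ - s / γ := by rw [hdef]; ring
    have h4 : s ^ 2 / 2 ≤ s / γ := by linarith
    rw [le_div_iff₀ hγ] at h4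
    have h5 : s * (s * γ) ≤ s * 2 := by linarith
    exact le_of_mul_le_mul_left h5 hs0
  have hcont : Continuous η := hw.sol.eta_smooth.continuous
  have habs : ∀ x, η |x| = η x := fun x => by
    rcases abs_cases x with ⟨h, _⟩ | ⟨h, _⟩ <;> rw [h]
    exact hw.eta_even x
  have hanti : ∀ x y : ℝ, 0 ≤ x → x ≤ y → η y ≤ η x := by
    intro x y hx hxy
    rcases hx.eq_or_lt with h | h
    · subst h
      rcases hxy.eq_or_lt with h' | h'
      · rw [h']
      · exact column_closure hcont h' (fun z hz0 hz1 => (hw.eta_anti hz0 h' hz1).le) le_rfl h'.le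
    · rcases hxy.eq_or_lt with h' | h'
      · rw [h']
      · exact (hw.eta_anti h (h.trans h') h').le
  have hmono : ∀ x y : ℝ, |x| ≤ |y| → η y ≤ η x := by
    intro x y h
    rw [← habs x, ← habs y]
    exact hanti _ _ (abs_nonneg x) h
  have hge : ∀ x, d ≤ η x := by
    intro x
    refine le_of_forall_pos_le_add fun ε hε => ?_
    obtain ⟨X, hX⟩ := hasym ε hε
    have h1 := (hX (max X |x|) ((le_max_left _ _).trans (le_abs_self _))).1
    have h2 := hmono x (max X |x|) ((le_max_right _ _).trans (le_abs_self _))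
    have h3 := neg_abs_le (η (max X |x|) - d)
    linarith
  have S : Setup γ s d r ψ η :=
    { hγ := hγ1, hs := hs0, hsγ := hsγ, hd := hd0, hdq := hdq, hr := hrr, sol := hw.sol,
      psi_even := hw.psi_even, uni := huni, eta_ge := hge,
      eta_le := fun x => hmono 0 x (by simp), eta_mono := hmono, asym := hasym }
  have h1 := S.amplitude (by linarith)
  have h2 : d ≤ ⨅ x : ℝ, η x := le_ciInf hge
  linarith
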